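/- Let A be a nonempty countable set of players, C a nonempty finite set of choices, d : C* → A, and for each a ∈ A let f_a : C^ω → [0,1] be upper semicontinuous, where C^ω carries the product topology induced by the discrete topology on C. Then the infinite sequential game ⟨A, C, d, (f_a)_{a∈A}⟩ has a Nash equilibrium: a strategy profile σ such that for every player a and every a-deviation σ', f_a(p(σ')) ≤ f_a(p(σ)). -/

import Mathlib

namespace SeqGame

variable {A C O : Type*}

/-- The length-`n` prefix of an infinite sequence, as a list. -/
def pre (p : ℕ → C) (n : ℕ) : List C := List.ofFn (fun i : Fin n => p i)

/-- The length-`n` history of the play induced by the strategy profile `σ` starting at `γ`. -/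
def hist (σ : List C → C) (γ : List C) : ℕ → List C
  | 0 => []
  | n + 1 => hist σ γ n ++
      [if h : n < γ.length then γ.get ⟨n, h⟩ else σ (hist σ γ n)]

/-- The play `p^γ(σ)` induced by the strategy profile `σ` starting at `γ`. -/
def play (σ : List C → C) (γ : List C) (n : ℕ) : C :=
  if h : n < γ.length then γ.get ⟨n, h⟩ else σ (hist σ γ n)

/-- `σ'` is an `a`-deviation of the strategy profile `σ`. -/
def Dev (d : List C → A) (a : A) (σ σ' : List C → C) : Prop :=
  ∀ h : List C, d h ≠ a → σ' h = σ h

end SeqGame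


namespace SeqGame

open Filter Topology

section Prefixes

variable {C : Type*}

@[simp]
theorem length_pre (p : ℕ → C) (n : ℕ) : (pre p n).length = n := by
  simp [pre]

@[simp]
theorem pre_zero (p : ℕ → C) : pre p 0 = [] := by
  simp [pre]

theorem getElem?_pre (q : ℕ → C) {m n : ℕ} (h : n < m) : (pre q m)[n]? = some (q n) := by
  simp [pre, h]

theorem pre_succ (p : ℕ → C) (n : ℕ) : pre p (n + 1) = pre p n ++ [p n] := by
  rw [pre, List.ofFn_succ_last]
  rfl

theorem pre_succ_eq_append {p : ℕ → C} {n : ℕ} {h : List C} {c : C}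
    (hp : pre p (n + 1) = h ++ [c]) : pre p n = h ∧ p n = c := by
  rw [pre_succ] at hp
  simpa using List.append_inj' hp rfl

theorem pre_eq_pre_iff {p q : ℕ → C} {n : ℕ} :
    pre p n = pre q n ↔ ∀ i < n, p i = q i := by
  induction n with
  | zero => simp
  | succ n ih =>
    rw [pre_succ, pre_succ]
    constructor
    · intro h i hi
      obtain ⟨h₁, h₂⟩ := List.append_inj' h rfl
      rcases Nat.lt_succ_iff_lt_or_eq.mp hi with hi | rfl
      · exact ih.mp h₁ i hi
      · simpa using h₂
    · intro h
      rw [ih.mpr fun i hi => h i (by omega), h n (by omega)]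

theorem hist_eq_pre_play (σ : List C → C) (γ : List C) (n : ℕ) :
    hist σ γ n = pre (play σ γ) n := by
  induction n with
  | zero => simp [hist]
  | succ n ih => rw [pre_succ, ← ih]; rfl

theorem pre_play_length (σ : List C → C) (γ : List C) : pre (play σ γ) γ.length = γ := by
  refine List.ext_getElem (by simp) fun i h₁ h₂ => ?_
  simp [pre, play]

theorem play_eq_of_length_le (σ : List C → C) {γ : List C} {n : ℕ} (h : γ.length ≤ n) :
    play σ γ n = σ (pre (play σ γ) n) := by
  rw [← hist_eq_pre_play]
  simp [play, Nat.not_lt.mpr h]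

theorem play_nil (σ : List C → C) (n : ℕ) :
    play σ [] n = σ (pre (play σ []) n) :=
  play_eq_of_length_le σ (by simp)

theorem play_eq_of_forall {σ : List C → C} {p : ℕ → C} (h : ∀ n, σ (pre p n) = p n) : play σ [] = p := by
  funext n
  induction n using Nat.strong_induction_on with
  | _ n ih => rw [play_nil, pre_eq_pre_iff.mpr ih, h]

/-- The superlevel sets of an upper semicontinuous function are closed under limits of plays. -/
theorem le_of_forall_exists_pre_eq [TopologicalSpace C] [DiscreteTopology C]
    {f : (ℕ → C) → ℝ} (hf : UpperSemicontinuous f) {p : ℕ → C} {y : ℝ} {N : ℕ}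
    (h : ∀ m ≥ N, ∃ q, pre q m = pre p m ∧ y ≤ f q) : y ≤ f p := by
  by_contra! hy
  have : Nonempty (ℕ → C) := ⟨p⟩
  choose! q hq hqy using h
  have hlim : Tendsto q atTop (𝓝 p) := by
    refine tendsto_pi_nhds.mpr fun i => tendsto_const_nhds.congr' ?_
    filter_upwards [eventually_ge_atTop N, eventually_gt_atTop i] with m hm hi
    exact (pre_eq_pre_iff.mp (hq m hm) i hi).symm
  obtain ⟨m, hm, hmN⟩ :=
    ((hlim.eventually (hf p y hy)).and (eventually_ge_atTop N)).exists
  exact absurd (hqy m hmN) (not_le.mpr hm)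

end Prefixes

section Strategies

variable {C : Type*} {P : List C → Prop} {s : List C → C} {S : Set (ℕ → C)}

/-- From time `n` on, the play `p` obeys the strategy `s` at the positions in `P`. -/
def Follows (P : List C → Prop) (s : List C → C) (p : ℕ → C) (n : ℕ) : Prop :=
  ∀ m ≥ n, P (pre p m) → p m = s (pre p m)

/-- From the position `h`, the coalition owning the positions in `P` ensures that the play is in
`S` by using the strategy `s`. -/
def Enforces (P : List C → Prop) (s : List C → C) (S : Set (ℕ → C)) (h : List C) : Prop :=
  ∀ p n, pre p n = h → Follows P s p n → p ∈ S

/-- From the position `h`, the coalition owning the positions in `P` can ensure that the play is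
in `S`. -/
def Wins (P : List C → Prop) (S : Set (ℕ → C)) (h : List C) : Prop :=
  ∃ s, Enforces P s S h

theorem Follows.mono {p : ℕ → C} {m n : ℕ} (h : Follows P s p m) (hmn : m ≤ n) :
    Follows P s p n :=
  fun k hk => h k (hmn.trans hk)

theorem follows_play (P : List C → Prop) (s : List C → C) (h : List C) :
    Follows P s (play s h) h.length :=
  fun _ hm _ => play_eq_of_length_le s hm

theorem Enforces.step {h : List C} {c : C} (hs : Enforces P s S h) (hc : P h → c = s h) :
    Enforces P s S (h ++ [c]) := by
  intro p n hp hfol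
  obtain rfl : n = h.length + 1 := by simpa using congrArg List.length hp
  obtain ⟨h₁, h₂⟩ := pre_succ_eq_append hp
  refine hs p _ h₁ fun m hm hP => ?_
  rcases hm.eq_or_lt with rfl | hm
  · rw [h₁] at hP ⊢
    rw [h₂, hc hP]
  · exact hfol m hm hP

theorem Wins.mono {T : Set (ℕ → C)} {h : List C} (hw : Wins P S h) (hST : S ⊆ T) :
    Wins P T h :=
  let ⟨s, hs⟩ := hw
  ⟨s, fun p n hp hfol => hST (hs p n hp hfol)⟩

theorem Wins.exists_step {h : List C} (hw : Wins P S h) : ∃ c, Wins P S (h ++ [c]) :=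
  let ⟨s, hs⟩ := hw
  ⟨s h, s, hs.step fun _ => rfl⟩

theorem Wins.step_of_not {h : List C} (hw : Wins P S h) (hP : ¬ P h) (c : C) :
    Wins P S (h ++ [c]) :=
  let ⟨s, hs⟩ := hw
  ⟨s, hs.step fun h => absurd h hP⟩

theorem Wins.exists_mem {h : List C} (hw : Wins P S h) :
    ∃ p ∈ S, pre p h.length = h :=
  let ⟨s, hs⟩ := hw
  ⟨play s h, hs _ _ (pre_play_length s h) (follows_play P s h), pre_play_length s h⟩

open Classical in
/-- The first strategy, in a fixed well-order, that enforces the objective `O h` from `h`. -/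
noncomputable def leastWinning [Nonempty C] (P : List C → Prop) (O : List C → Set (ℕ → C))
    (h : List C) : List C → C :=
  if hw : Wins P (O h) h then
    (IsWellFounded.wf (r := WellOrderingRel (α := List C → C))).min {s | Enforces P s (O h) h} hw
  else Classical.arbitrary _

/-- At each position `h`, play as the first strategy that enforces `O h` from `h`. -/
noncomputable def uniform [Nonempty C] (P : List C → Prop) (O : List C → Set (ℕ → C))
    (h : List C) : C :=
  leastWinning P O h h

variable [Nonempty C] {O : List C → Set (ℕ → C)}

theorem enforces_leastWinning {h : List C} (hw : Wins P (O h) h) :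
    Enforces P (leastWinning P O h) (O h) h := by
  rw [leastWinning, dif_pos hw]
  exact WellFounded.min_mem _ {s | Enforces P s (O h) h} hw

theorem not_rel_leastWinning {h : List C} (hs : Enforces P s (O h) h) :
    ¬ WellOrderingRel s (leastWinning P O h) := by
  have hw : Wins P (O h) h := ⟨s, hs⟩
  rw [leastWinning, dif_pos hw]
  exact WellFounded.not_lt_min _ {s | Enforces P s (O h) h} hs

theorem enforces_leastWinning_step {h : List C} {c : C} (hw : Wins P (O h) h)
    (hc : P h → c = uniform P O h) :
    Enforces P (leastWinning P O h) (O h) (h ++ [c]) :=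
  (enforces_leastWinning hw).step hc

/-- A play that follows the uniform strategy, and along which the objective is constant,
satisfies this objective. -/
theorem mem_of_follows_uniform {p : ℕ → C} {N : ℕ} (hfol : Follows P (uniform P O) p N)
    (hO : ∀ n ≥ N, O (pre p n) = O (pre p N)) (hw : Wins P (O (pre p N)) (pre p N)) :
    p ∈ O (pre p N) := by
  have hstep : ∀ n ≥ N, Wins P (O (pre p n)) (pre p n) →
      Enforces P (leastWinning P O (pre p n)) (O (pre p (n + 1))) (pre p (n + 1)) := by
    intro n hn hwn
    rw [hO (n + 1) (by omega), ← hO n hn, pre_succ]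
    exact enforces_leastWinning_step hwn (hfol n hn)
  have hwins : ∀ n ≥ N, Wins P (O (pre p n)) (pre p n) := by
    intro n hn
    induction n, hn using Nat.le_induction with
    | base => exact hw
    | succ n hn ih => exact ⟨_, hstep n hn ih⟩
  obtain ⟨_, ⟨k, hk, rfl⟩, hmin⟩ :=
    (IsWellFounded.wf (r := WellOrderingRel (α := List C → C))).has_min
      ((fun n => leastWinning P O (pre p n)) '' Set.Ici N) ⟨_, N, Set.mem_Ici.mpr le_rfl, rfl⟩
  have hk : N ≤ k := hk
  have hconst : ∀ n ≥ k, leastWinning P O (pre p n) = leastWinning P O (pre p k) := by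
    intro n hn
    induction n, hn using Nat.le_induction with
    | base => rfl
    | succ n hn ih =>
      have h₁ := not_rel_leastWinning (hstep n (hk.trans hn) (hwins n (hk.trans hn)))
      rw [ih] at h₁
      have h₂ := hmin _ ⟨n + 1, Set.mem_Ici.mpr (by omega), rfl⟩
      exact (Std.Trichotomous.trichotomous _ _ h₁ h₂).symm
  rw [← hO k hk]
  refine enforces_leastWinning (hwins k hk) p k rfl fun m hm hP => ?_
  rw [hfol m (hk.trans hm) hP, uniform, hconst m hm]

theorem enforces_uniform_const {h : List C} (hw : Wins P S h) :
    Enforces P (uniform P fun _ => S) S h := by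
  rintro p n rfl hfol
  exact mem_of_follows_uniform (O := fun _ => S) hfol (fun _ _ => rfl) hw

end Strategies

section Determinacy

variable {C : Type*} {P : List C → Prop} {G T : Set (List C)}

/-- The positions from which the opponents of the coalition owning `P` can force the play, within
`k` moves and without visiting `G`, to reach a position outside of `T`. -/
def Escape (P : List C → Prop) (G T : Set (List C)) : ℕ → List C → Prop
  | 0, h => h ∉ G ∧ h ∉ T
  | k + 1, h => Escape P G T k h ∨
      h ∉ G ∧ (P h → ∀ c, Escape P G T k (h ++ [c])) ∧ (¬ P h → ∃ c, Escape P G T k (h ++ [c]))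

theorem Escape.not_mem {k : ℕ} {h : List C} (he : Escape P G T k h) : h ∉ G := by
  induction k with
  | zero => exact he.1
  | succ k ih => exact he.elim ih And.left

theorem Escape.mono {k l : ℕ} {h : List C} (he : Escape P G T k h) (hkl : k ≤ l) :
    Escape P G T l h := by
  induction l, hkl using Nat.le_induction with
  | base => exact he
  | succ l _ ih => exact Or.inl ih

/-- An escape from a position of `T` makes progress at the next move. -/
theorem Escape.exists_pred {k : ℕ} {h : List C} (he : Escape P G T k h) (hT : h ∈ T) :
    ∃ l < k, (P h → ∀ c, Escape P G T l (h ++ [c])) ∧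
      (¬ P h → ∃ c, Escape P G T l (h ++ [c])) := by
  induction k with
  | zero => exact absurd hT he.2
  | succ k ih =>
    rcases he with he | he
    · obtain ⟨l, hl, h'⟩ := ih he
      exact ⟨l, by omega, h'⟩
    · exact ⟨k, by omega, he.2⟩

theorem exists_escape_of_forall [Finite C] {h : List C}
    (he : ∀ c, ∃ k, Escape P G T k (h ++ [c])) :
    ∃ k, ∀ c, Escape P G T k (h ++ [c]) := by
  choose k hk using he
  obtain ⟨K, hK⟩ := (Set.finite_range k).bddAbove
  exact ⟨K, fun c => (hk c).mono (hK ⟨c, rfl⟩)⟩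

/-- The positions through which some play reaches the level `y` of `f`. -/
def reaching (f : (ℕ → C) → ℝ) (y : ℝ) : Set (List C) :=
  {h | ∃ p, pre p h.length = h ∧ y ≤ f p}

theorem mem_reaching_of_le {f : (ℕ → C) → ℝ} {y : ℝ} {p : ℕ → C} {m n : ℕ} (hmn : m ≤ n)
    (h : pre p n ∈ reaching f y) : pre p m ∈ reaching f y := by
  obtain ⟨q, hq, hy⟩ := h
  rw [length_pre, pre_eq_pre_iff] at hq
  refine ⟨q, ?_, hy⟩
  rw [length_pre, pre_eq_pre_iff]
  exact fun i hi => hq i (hi.trans_le hmn)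

variable [TopologicalSpace C] [DiscreteTopology C] {f : (ℕ → C) → ℝ}

theorem le_of_forall_mem_reaching (hf : UpperSemicontinuous f) {p : ℕ → C} {y : ℝ} {N : ℕ}
    (h : ∀ m ≥ N, pre p m ∈ reaching f y) : y ≤ f p := by
  refine le_of_forall_exists_pre_eq hf (N := N) fun m hm => ?_
  simpa [reaching] using h m hm

variable [Nonempty C] [Finite C]

/-- From a position where `P` cannot ensure `r < f`, the opponents can force the play out of
`reaching f y`, for all `y > r`, while remaining at such positions. -/
theorem exists_escape_of_not_wins (hf : UpperSemicontinuous f) {r y : ℝ} (hry : r < y)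
    {h : List C} (hw : ¬ Wins P {p | r < f p} h) :
    ∃ k, Escape P {g | Wins P {p | r < f p} g} (reaching f y) k h := by
  classical
  set G : Set (List C) := {g | Wins P {p | r < f p} g} with hG
  by_contra! hne
  let Y : Set (List C) := {g | ∀ k, ¬ Escape P G (reaching f y) k g}
  have hYT : ∀ g ∈ Y, g ∉ G → g ∈ reaching f y := by
    intro g hg hgG
    by_contra hT
    exact hg 0 ⟨hgG, hT⟩
  have hYP : ∀ g ∈ Y, g ∉ G → P g → ∃ c, g ++ [c] ∈ Y := by
    intro g hg hgG hP
    by_contra! hcon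
    obtain ⟨k, hk⟩ := exists_escape_of_forall (P := P) (G := G) (T := reaching f y) (h := g)
      fun c => by simpa [Y] using hcon c
    exact hg (k + 1) (Or.inr ⟨hgG, fun _ => hk, fun h => absurd hP h⟩)
  have hYN : ∀ g ∈ Y, g ∉ G → ¬ P g → ∀ c, g ++ [c] ∈ Y := by
    intro g hg hgG hP c k hk
    exact hg (k + 1) (Or.inr ⟨hgG, fun h => absurd h hP, fun _ => ⟨c, hk⟩⟩)
  let u : List C → C := uniform P fun _ => {p | r < f p}
  let s : List C → C := fun g =>
    if g ∈ G then u g else if hc : ∃ c, g ++ [c] ∈ Y then hc.choose else Classical.arbitrary C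
  refine hw ⟨s, ?_⟩
  rintro p n rfl hfol
  by_cases hvisit : ∃ m ≥ n, pre p m ∈ G
  · obtain ⟨m, hm, hmG⟩ := hvisit
    have hstay : ∀ k ≥ m, pre p k ∈ G := by
      intro k hk
      induction k, hk using Nat.le_induction with
      | base => exact hmG
      | succ k hk ih =>
        rw [pre_succ]
        refine ⟨u, (enforces_uniform_const ih).step fun hP => ?_⟩
        rw [hfol k (hm.trans hk) hP]
        exact if_pos ih
    refine enforces_uniform_const hmG p m rfl fun k hk hP => ?_
    rw [hfol k (hm.trans hk) hP]
    exact if_pos (hstay k hk)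
  · push Not at hvisit
    have hstay : ∀ k ≥ n, pre p k ∈ Y := by
      intro k hk
      induction k, hk using Nat.le_induction with
      | base => exact hne
      | succ k hk ih =>
        rw [pre_succ]
        by_cases hP : P (pre p k)
        · have hc := hYP _ ih (hvisit k hk) hP
          rw [hfol k hk hP]
          simp only [s, if_neg (hvisit k hk), dif_pos hc]
          exact hc.choose_spec
        · exact hYN _ ih (hvisit k hk) hP _
    exact hry.trans_le <| le_of_forall_mem_reaching hf (N := n)
      fun m hm => hYT _ (hstay m hm) (hvisit m hm)

/-- Determinacy: if a coalition cannot ensure `r < f`, then its opponents can ensure `f ≤ r`. -/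
theorem wins_not_of_not_wins (hf : UpperSemicontinuous f) {r : ℝ} {h : List C}
    (hw : ¬ Wins P {p | r < f p} h) : Wins (fun g => ¬ P g) {p | f p ≤ r} h := by
  classical
  set G : Set (List C) := {g | Wins P {p | r < f p} g} with hG
  let T : ℕ → Set (List C) := fun n => reaching f (r + 1 / (n + 1 : ℝ))
  have hE : ∀ n, ∀ g ∉ G, ∃ k, Escape P G (T n) k g := fun n g hg =>
    exists_escape_of_not_wins hf (by linarith [Nat.one_div_pos_of_nat (α := ℝ) (n := n)]) hg
  let level : List C → ℕ := fun g => if hn : ∃ n, g ∈ T n then Nat.find hn else 0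
  let rank : ℕ → List C → ℕ := fun n g =>
    if hk : ∃ k, Escape P G (T n) k g then Nat.find hk else 0
  let s : List C → C := fun g =>
    if hc : ∃ c, ∃ k < rank (level g) g, Escape P G (T (level g)) k (g ++ [c]) then hc.choose
    else Classical.arbitrary C
  have hlevel : ∀ g n, g ∈ T n → (∀ k < n, g ∉ T k) → level g = n := by
    intro g n hn hk
    have hex : ∃ n, g ∈ T n := ⟨n, hn⟩
    simp only [level, dif_pos hex]
    exact (Nat.find_eq_iff hex).mpr ⟨hn, hk⟩
  have hrank : ∀ n k g, Escape P G (T n) k g → rank n g ≤ k := by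
    intro n k g hk
    have hex : ∃ k, Escape P G (T n) k g := ⟨k, hk⟩
    simp only [rank, dif_pos hex]
    exact Nat.find_min' hex hk
  have hescape : ∀ n, ∀ g ∉ G, Escape P G (T n) (rank n g) g := by
    intro n g hg
    simp only [rank, dif_pos (hE n g hg)]
    exact Nat.find_spec (hE n g hg)
  have hprogress : ∀ g ∉ G, g ∈ T (level g) → ∀ c, (¬ P g → c = s g) →
      ∃ k < rank (level g) g, Escape P G (T (level g)) k (g ++ [c]) := by
    intro g hg hT c hc
    obtain ⟨l, hl, h₁, h₂⟩ := (hescape (level g) g hg).exists_pred hT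
    by_cases hP : P g
    · exact ⟨l, hl, h₁ hP c⟩
    · obtain ⟨c', hc'⟩ := h₂ hP
      have hex : ∃ c, ∃ k < rank (level g) g, Escape P G (T (level g)) k (g ++ [c]) :=
        ⟨c', l, hl, hc'⟩
      rw [hc hP]
      simp only [s, dif_pos hex]
      exact hex.choose_spec
  refine ⟨s, ?_⟩
  rintro p N rfl hfol
  change f p ≤ r
  have hleave : ∀ n m, pre p m ∉ T n → f p < r + 1 / (n + 1 : ℝ) := by
    intro n m hm
    by_contra! hle
    exact hm ⟨p, by simp, hle⟩
  suffices hT : ∀ n, ∃ m ≥ N, pre p m ∉ T n by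
    refine le_of_forall_pos_lt_add fun ε hε => ?_
    obtain ⟨n, hn⟩ := exists_nat_one_div_lt hε
    obtain ⟨m, -, hm⟩ := hT n
    linarith [hleave n m hm]
  by_cases hall : ∃ m ≥ N, ∀ n, pre p m ∉ T n
  · obtain ⟨m, hm, hmT⟩ := hall
    exact fun n => ⟨m, hm, hmT n⟩
  push Not at hall
  have hmem : ∀ m ≥ N, pre p m ∈ T (level (pre p m)) := by
    intro m hm
    simp only [level, dif_pos (hall m hm)]
    exact Nat.find_spec (hall m hm)
  have hG : ∀ m ≥ N, pre p m ∉ G := by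
    intro m hm
    induction m, hm using Nat.le_induction with
    | base => exact hw
    | succ m hm ih =>
      obtain ⟨k, -, hk⟩ := hprogress _ ih (hmem m hm) (p m) (hfol m hm)
      rw [pre_succ]
      exact hk.not_mem
  intro n
  induction n using Nat.strong_induction_on with
  | _ n ih =>
    by_contra! hn
    have hev : ∀ᶠ m in atTop, ∀ k ∈ Set.Iio n, pre p m ∉ T k := by
      rw [eventually_all_finite (Set.finite_Iio n)]
      intro k hk
      obtain ⟨M, -, hM⟩ := ih k hk
      filter_upwards [eventually_ge_atTop M] with m hm hmT
      exact hM (mem_reaching_of_le hm hmT)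
    obtain ⟨M, hM⟩ := eventually_atTop.mp (hev.and (eventually_ge_atTop N))
    have hlev : ∀ m ≥ M, level (pre p m) = n := fun m hm =>
      hlevel _ n (hn m (hM m hm).2) (hM m hm).1
    have hdesc : ∀ j, rank n (pre p (M + j)) + j ≤ rank n (pre p M) := by
      intro j
      induction j with
      | zero => rfl
      | succ j ihj =>
        have hMj : N ≤ M + j := (hM (M + j) (by omega)).2
        obtain ⟨k, hk, he⟩ := hprogress _ (hG _ hMj) (hmem _ hMj) (p (M + j)) (hfol _ hMj)
        rw [hlev _ (by omega)] at hk he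
        rw [← pre_succ] at he
        have := hrank n k _ he
        rw [add_assoc] at this
        omega
    have := hdesc (rank n (pre p M) + 1)
    omega

end Determinacy

section Thresholds

variable {C : Type*} {P : List C → Prop} {f : (ℕ → C) → ℝ} {h : List C}

/-- The levels that the coalition owning `P` can ensure to exceed from the position `h`. -/
def levels (P : List C → Prop) (f : (ℕ → C) → ℝ) (h : List C) : Set ℝ :=
  {r | Wins P {p | r < f p} h}

/-- The plays that exceed all the levels that the coalition owning `P` can ensure to exceed from
the position `h`. -/
def optimal (P : List C → Prop) (f : (ℕ → C) → ℝ) (h : List C) : Set (ℕ → C) :=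
  {p | ∀ r ∈ levels P f h, r < f p}

theorem levels_of_le {r t : ℝ} (ht : t ∈ levels P f h) (hrt : r ≤ t) : r ∈ levels P f h :=
  Wins.mono ht fun _ hp => hrt.trans_lt hp

theorem levels_subset_of_wins {g : List C} (hw : Wins P (optimal P f h) g) :
    levels P f h ⊆ levels P f g :=
  fun r hr => hw.mono fun _ hp => hp r hr

theorem exists_levels_subset [Nonempty C] [Finite C] {g : List C}
    (hg : levels P f h ⊆ levels P f g) : ∃ c, levels P f h ⊆ levels P f (g ++ [c]) := by
  by_contra! hcon
  simp only [Set.not_subset] at hcon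
  choose r hr hrc using hcon
  obtain ⟨c₀, hc₀⟩ := Finite.exists_max r
  obtain ⟨c, hc⟩ := Wins.exists_step (hg (hr c₀))
  exact hrc c (levels_of_le hc (hc₀ c))

variable [TopologicalSpace C] [DiscreteTopology C]

theorem le_of_forall_mem_levels (hf : UpperSemicontinuous f) {p : ℕ → C} {r : ℝ} {N : ℕ}
    (hp : ∀ m ≥ N, r ∈ levels P f (pre p m)) : r ≤ f p := by
  refine le_of_forall_exists_pre_eq hf (N := N) fun m hm => ?_
  obtain ⟨q, hq, hqm⟩ := Wins.exists_mem (hp m hm)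
  rw [length_pre] at hqm
  exact ⟨q, hqm, le_of_lt hq⟩

variable [Nonempty C] [Finite C]

/-- All the levels that can be exceeded separately can be exceeded simultaneously. -/
theorem wins_optimal (hf : UpperSemicontinuous f) (h : List C) : Wins P (optimal P f h) h := by
  classical
  by_cases hmax : ∃ t ∈ levels P f h, ∀ r ∈ levels P f h, r ≤ t
  · obtain ⟨t, ht, hle⟩ := hmax
    exact Wins.mono ht fun p hp r hr => (hle r hr).trans_lt hp
  push Not at hmax
  let s : List C → C := fun g =>
    if hc : ∃ c, levels P f h ⊆ levels P f (g ++ [c]) then hc.choose else Classical.arbitrary C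
  refine ⟨s, ?_⟩
  rintro p N rfl hfol
  have hsub : ∀ m ≥ N, levels P f (pre p N) ⊆ levels P f (pre p m) := by
    intro m hm
    induction m, hm using Nat.le_induction with
    | base => rfl
    | succ m hm ih =>
      rw [pre_succ]
      by_cases hP : P (pre p m)
      · have hc := exists_levels_subset ih
        rw [hfol m hm hP]
        simp only [s, dif_pos hc]
        exact hc.choose_spec
      · exact fun r hr => Wins.step_of_not (ih hr) hP _
  intro r hr
  obtain ⟨t, ht, hrt⟩ := hmax r hr
  exact hrt.trans_le (le_of_forall_mem_levels hf fun m hm => hsub m hm ht)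

/-- A play in which the coalition owning `P` uses the uniform optimal strategy exceeds, at each
position, all the levels that this coalition can ensure to exceed. -/
theorem not_mem_levels_of_follows (hf : UpperSemicontinuous f) {p : ℕ → C}
    (hfol : Follows P (uniform P (optimal P f)) p 0) (N : ℕ) : f p ∉ levels P f (pre p N) := by
  intro hN
  have hstep : ∀ n, levels P f (pre p n) ⊆ levels P f (pre p (n + 1)) := by
    intro n
    rw [pre_succ]
    exact levels_subset_of_wins
      ⟨_, enforces_leastWinning_step (wins_optimal hf _) (hfol n n.zero_le)⟩
  have hmono : Monotone fun n => levels P f (pre p n) := monotone_nat_of_le_succ hstep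
  have hconst : ∀ n ≥ N, levels P f (pre p n) = levels P f (pre p N) := by
    refine fun n hn => (hmono hn).antisymm' fun t ht => ?_
    by_contra htN
    have htp : t ≤ f p := le_of_forall_mem_levels hf fun m hm => hmono hm ht
    exact htN (levels_of_le hN htp)
  have hp := mem_of_follows_uniform (hfol.mono N.zero_le)
    (fun n hn => by simp only [optimal, hconst n hn]) (wins_optimal hf (pre p N))
  exact lt_irrefl _ (hp _ hN)

end Thresholds

section Equilibrium

variable {A C : Type*} [Nonempty C] {d : List C → A} {f : A → (ℕ → C) → ℝ} {p : ℕ → C}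

/-- The strategy of the opponents of `a` that holds the payoff of `a` down to that of the play `p`,
wherever this is possible. -/
noncomputable def punish (d : List C → A) (f : A → (ℕ → C) → ℝ) (p : ℕ → C) (a : A) :
    List C → C :=
  uniform (fun g => ¬ d g = a) fun _ => {q | f a q ≤ f a p}

open Classical in
/-- Play along `p`; after a first departure from `p`, punish the player moving at that point. -/
noncomputable def grimTrigger (d : List C → A) (f : A → (ℕ → C) → ℝ) (p : ℕ → C)
    (h : List C) : C :=
  if hn : ∃ n < h.length, h[n]? ≠ some (p n) then
    punish d f p (d (pre p (Nat.find hn))) h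
  else p h.length

theorem grimTrigger_pre (n : ℕ) : grimTrigger d f p (pre p n) = p n := by
  have hn : ¬ ∃ k < (pre p n).length, (pre p n)[k]? ≠ some (p k) := by
    rintro ⟨k, hk, hne⟩
    exact hne (getElem?_pre p (by simpa using hk))
  rw [grimTrigger, dif_neg hn, length_pre]

theorem grimTrigger_of_departure {q : ℕ → C} {m n : ℕ} (hpq : ∀ i < n, q i = p i)
    (hne : q n ≠ p n) (hnm : n < m) :
    grimTrigger d f p (pre q m) = punish d f p (d (pre p n)) (pre q m) := by
  classical
  have hdep : n < (pre q m).length ∧ (pre q m)[n]? ≠ some (p n) := by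
    rw [getElem?_pre q hnm]
    simpa using ⟨hnm, hne⟩
  have hn : ∃ k < (pre q m).length, (pre q m)[k]? ≠ some (p k) := ⟨n, hdep⟩
  have hfind : Nat.find hn = n := by
    refine (Nat.find_eq_iff hn).mpr ⟨hdep, fun k hk hk' => hk'.2 ?_⟩
    rw [getElem?_pre q (hk.trans hnm), hpq k hk]
  rw [grimTrigger, dif_pos hn]
  congr 3

variable [Finite C] [TopologicalSpace C] [DiscreteTopology C]

/-- A play along which no player can ensure to exceed their payoff is induced by a Nash
equilibrium. -/
theorem grimTrigger_isNash (husc : ∀ a, UpperSemicontinuous (f a))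
    (hp : ∀ a n, f a p ∉ levels (fun g => d g = a) (f a) (pre p n)) (a : A) (σ' : List C → C)
    (hdev : Dev d a (grimTrigger d f p) σ') :
    f a (play σ' []) ≤ f a (play (grimTrigger d f p) []) := by
  classical
  rw [play_eq_of_forall (σ := grimTrigger d f p) grimTrigger_pre]
  set q := play σ' [] with hq
  by_cases hqp : ∃ n, q n ≠ p n
  · let n := Nat.find hqp
    have hne : q n ≠ p n := Nat.find_spec hqp
    have hpq : ∀ i < n, q i = p i := fun i hi => not_not.mp (Nat.find_min hqp hi)
    have hpre : pre q n = pre p n := pre_eq_pre_iff.mpr hpq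
    have ha : d (pre p n) = a := by
      by_contra hd
      apply hne
      rw [hq, play_nil, ← hq, hpre, hdev _ hd, grimTrigger_pre]
    have hw : Wins (fun g => ¬ d g = a) {q | f a q ≤ f a p} (pre q (n + 1)) := by
      rw [pre_succ, hpre]
      exact (wins_not_of_not_wins (husc a) (hp a n)).step_of_not (not_not.mpr ha) _
    refine enforces_uniform_const hw q (n + 1) rfl fun m hm hd => ?_
    rw [hq, play_nil, ← hq, hdev _ hd, grimTrigger_of_departure hpq hne (by omega), ha]
    rfl
  · push Not at hqp
    rw [funext hqp]

end Equilibrium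

end SeqGame

open SeqGame in
/-- an infinite sequential game with countably many players, finitely many
choices and upper semicontinuous payoff functions into `[0,1]` has a Nash equilibrium. -/
theorem stmt14 {A C : Type*} [Nonempty A] [Countable A] [Nonempty C] [Finite C]
    [TopologicalSpace C] [DiscreteTopology C]
    (d : List C → A) (f : A → (ℕ → C) → ℝ)
    (hf01 : ∀ (a : A) (p : ℕ → C), f a p ∈ Set.Icc (0 : ℝ) 1)
    (husc : ∀ a : A, UpperSemicontinuous (f a)) :
    ∃ σ : List C → C, ∀ (a : A) (σ' : List C → C), Dev d a σ σ' →
      f a (play σ' []) ≤ f a (play σ []) := by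
  let σ : List C → C := fun g =>
    uniform (fun h => d h = d g) (optimal (fun h => d h = d g) (f (d g))) g
  refine ⟨grimTrigger d f (play σ []), grimTrigger_isNash husc fun a n => ?_⟩
  refine not_mem_levels_of_follows (husc a) (fun m _ hm => ?_) n
  subst hm
  exact play_nil σ m
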